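/- For any positive integers a and H, the number of pairs of tuples (j₁,…,j_a), (l₁,…,l_a) with all entries in {1,…,H} such that (j₁,…,j_a) is a permutation of (l₁,…,l_a) (i.e. the two tuples are equal as multisets) is a!·(H^a + O(a² H^{a−1})), with an absolute implied constant. -/

import Mathlib

open MeasureTheory ProbabilityTheory

noncomputable section

namespace ShortHybrid

/-- The uniform probability measure on the unit circle in `ℂ`. -/
def uniformCircle : Measure ℂ :=
  (ENNReal.ofReal (2 * Real.pi)⁻¹) •
    Measure.map (fun t : ℝ => Complex.exp (t * Complex.I))
      (volume.restrict (Set.Ioc 0 (2 * Real.pi)))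

open scoped Classical in
/-- The number of pairs of tuples `(j₁,…,j_a), (l₁,…,l_a) ∈ {1,…,H}^a` such that one is a
permutation of the other (i.e. they agree as multisets). -/
def permCount (H a : ℕ) : ℕ :=
  (Finset.univ.filter
    (fun jl : (Fin a → Fin H) × (Fin a → Fin H) =>
      ∃ σ : Equiv.Perm (Fin a), ∀ i, jl.1 i = jl.2 (σ i))).card

end ShortHybrid

open ShortHybrid in
theorem permCount_le (H a : ℕ) : permCount H a ≤ a.factorial * H ^ a := by
  classical
  have h : permCount H a ≤ (Finset.univ.image
      (fun p : Equiv.Perm (Fin a) × (Fin a → Fin H) => (p.2 ∘ p.1, p.2))).card := by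
    unfold permCount
    apply Finset.card_le_card
    rintro ⟨j, l⟩ hjl
    simp only [Finset.mem_filter, Finset.mem_univ, true_and] at hjl
    obtain ⟨σ, hσ⟩ := hjl
    simp only [Finset.mem_image, Finset.mem_univ, true_and]
    exact ⟨(σ, l), Prod.ext (funext fun i => (hσ i).symm) rfl⟩
  refine h.trans (Finset.card_image_le.trans ?_)
  simp [Fintype.card_perm]

open ShortHybrid in
theorem le_permCount (H a : ℕ) : a.factorial * H.descFactorial a ≤ permCount H a := by
  classical
  have h : (Finset.univ : Finset (Equiv.Perm (Fin a) × (Fin a ↪ Fin H))).card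
      ≤ permCount H a := by
    unfold permCount
    apply Finset.card_le_card_of_injOn
      (fun p : Equiv.Perm (Fin a) × (Fin a ↪ Fin H) => ((p.2 : Fin a → Fin H) ∘ p.1, (p.2 : Fin a → Fin H)))
    · rintro ⟨σ, l⟩ _
      simp only [Finset.coe_filter, Finset.mem_univ, true_and, Set.mem_setOf_eq]
      exact ⟨σ, fun i => rfl⟩
    · rintro ⟨σ, l⟩ _ ⟨τ, m⟩ _ hh
      simp only [Prod.mk.injEq] at hh
      obtain ⟨h1, h2⟩ := hh
      have h3 : l = m := DFunLike.coe_injective h2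
      subst h3
      refine Prod.ext (Equiv.ext fun i => l.injective (congrFun h1 i)) rfl
  simpa [Fintype.card_perm, Fintype.card_embedding_eq] using h

theorem descFactorial_bound (H a : ℕ) :
    H ^ (a + 1) ≤ H * H.descFactorial a + a ^ 2 * H ^ a := by
  induction a with
  | zero => simp
  | succ a ih =>
    have h1 : H * H.descFactorial a ≤ H.descFactorial (a + 1) + a * H ^ a := by
      rw [Nat.descFactorial_succ]
      calc H * H.descFactorial a ≤ ((H - a) + a) * H.descFactorial a :=
            Nat.mul_le_mul_right _ (by omega)
        _ = (H - a) * H.descFactorial a + a * H.descFactorial a := by ring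
        _ ≤ _ := by gcongr; exact Nat.descFactorial_le_pow H a
    calc H ^ (a + 1 + 1) = H * H ^ (a + 1) := by ring
      _ ≤ H * (H.descFactorial (a + 1) + a * H ^ a + a ^ 2 * H ^ a) := by
          gcongr; omega
      _ = H * H.descFactorial (a + 1) + (a + a ^ 2) * H ^ (a + 1) := by ring
      _ ≤ _ := by gcongr; nlinarith

open ShortHybrid in
/-- The number of pairs of tuples `(j₁,…,j_a), (l₁,…,l_a)` with entries in `{1,…,H}` which
are permutations of each other is `a! (H^a + O(a² H^{a−1}))`, with an absolute implied
constant. -/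
theorem permCount_asymptotic :
    ∃ C : ℝ, 0 < C ∧
      ∀ a H : ℕ, 0 < a → 0 < H →
        ∃ err : ℝ, |err| ≤ C * a ^ 2 * (H : ℝ) ^ (a - 1) ∧
          (permCount H a : ℝ) = (a.factorial : ℝ) * ((H : ℝ) ^ a + err) := by
  refine ⟨1, one_pos, fun a H ha hH => ⟨(permCount H a : ℝ) / a.factorial - (H : ℝ) ^ a, ?_, ?_⟩⟩
  · have hf : (0 : ℝ) < a.factorial := by exact_mod_cast a.factorial_pos
    have hu : (permCount H a : ℝ) / a.factorial ≤ (H : ℝ) ^ a := by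
      rw [div_le_iff₀' hf]
      exact_mod_cast permCount_le H a
    have hl : (H.descFactorial a : ℝ) ≤ (permCount H a : ℝ) / a.factorial := by
      rw [le_div_iff₀' hf]
      exact_mod_cast le_permCount H a
    have hd : H ^ a ≤ H.descFactorial a + a ^ 2 * H ^ (a - 1) := by
      obtain ⟨b, rfl⟩ : ∃ b, a = b + 1 := ⟨a - 1, by omega⟩
      refine Nat.le_of_mul_le_mul_left ?_ hH
      have := descFactorial_bound H (b + 1)
      calc H * H ^ (b + 1) = H ^ (b + 1 + 1) := by ring
        _ ≤ _ := this
        _ = _ := by rw [Nat.add_sub_cancel]; ring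
    have hd' : (H : ℝ) ^ a ≤ H.descFactorial a + (a : ℝ) ^ 2 * (H : ℝ) ^ (a - 1) := by
      exact_mod_cast hd
    have : (0 : ℝ) ≤ (a : ℝ) ^ 2 * (H : ℝ) ^ (a - 1) := by positivity
    rw [abs_le]
    constructor <;> linarith
  · have hf : (a.factorial : ℝ) ≠ 0 := by exact_mod_cast a.factorial_ne_zero
    field_simp
    ring
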